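/- Let m ≥ 1 and n ≥ 0 be integers and set c = (m+1)·2^{−m}. Then the hat number of the digraph K_m^{→n} (the directed union of n disjoint copies of the complete digraph K_m) satisfies h(K_m^{→n}) ≥ (1 − (1−c)^n)·m/(m+1). -/

import Mathlib

namespace HatProblem

variable {V : Type*} [Fintype V] [DecidableEq V]

/-- A team strategy: each vertex maps a full configuration to a guess (`none` = pass),
depending only on the colors of its out-neighbors. -/
def IsStrategy (A : V → V → Prop) (S : V → (V → Bool) → Option Bool) : Prop :=
  ∀ (v : V) (c c' : V → Bool), (∀ u, A v u → c u = c' u) → S v c = S v c'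

/-- The team wins at configuration `c`: someone guesses correctly, nobody guesses wrong. -/
def Wins (S : V → (V → Bool) → Option Bool) (c : V → Bool) : Prop :=
  (∃ v, S v c = some (c v)) ∧ ∀ v b, S v c = some b → b = c v

/-- The chance of success of a strategy. -/
noncomputable def chance (S : V → (V → Bool) → Option Bool) : ℚ :=
  ({c : V → Bool | Wins S c}.ncard : ℚ) / 2 ^ Fintype.card V

/-- The hat number of a digraph: the maximal chance of success over all strategies. -/
noncomputable def hatNumber (A : V → V → Prop) : ℚ :=
  haveI : Fintype {S : V → (V → Bool) → Option Bool // IsStrategy A S} :=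
    Fintype.ofFinite _
  Finset.sup' (Finset.univ : Finset {S : V → (V → Bool) → Option Bool // IsStrategy A S})
    ⟨⟨fun _ _ => none, fun _ _ _ _ => rfl⟩, Finset.mem_univ _⟩
    fun S => chance S.1

/-- A clique in the skeleton of a digraph: vertices pairwise joined by arcs both ways. -/
def IsDiClique (A : V → V → Prop) (s : Finset V) : Prop :=
  ∀ x ∈ s, ∀ y ∈ s, x ≠ y → A x y ∧ A y x

/-- The clique number of a digraph: the clique number of its skeleton. -/
noncomputable def cliqueNum (A : V → V → Prop) : ℕ :=
  sSup {n | ∃ s : Finset V, IsDiClique A s ∧ s.card = n}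

/-- The directed union `C → D` of two digraphs. -/
def dUnion {W : Type*} (A : V → V → Prop) (B : W → W → Prop) :
    V ⊕ W → V ⊕ W → Prop
  | Sum.inl x, Sum.inl y => A x y
  | Sum.inl _, Sum.inr _ => True
  | Sum.inr _, Sum.inl _ => False
  | Sum.inr x, Sum.inr y => B x y

/-- The complete digraph on `m` vertices. -/
def completeArc (m : ℕ) : Fin m → Fin m → Prop := fun a b => a ≠ b

end HatProblem

namespace HatProblem

/-- The digraph `K_m^{→n}`: the directed union of `n` disjoint copies of `K_m`.
There is an arc from `(i, a)` to `(j, b)` iff `i < j`, or `i = j` and `a ≠ b`. -/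
def KmPowN (m n : ℕ) : Fin n × Fin m → Fin n × Fin m → Prop :=
  fun p q => p.1 < q.1 ∨ (p.1 = q.1 ∧ p.2 ≠ q.2)

open Finset

/-- Every strategy bounds the hat number from below. -/
theorem chance_le_hatNumber {V : Type*} [Fintype V] [DecidableEq V] {A : V → V → Prop}
    {S : V → (V → Bool) → Option Bool} (hS : IsStrategy A S) : chance S ≤ hatNumber A := by
  unfold hatNumber
  let : Fintype {S : V → (V → Bool) → Option Bool // IsStrategy A S} := Fintype.ofFinite _
  exact Finset.le_sup' (fun S : {S : V → (V → Bool) → Option Bool // IsStrategy A S} => chance S.1)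
    (Finset.mem_univ (⟨S, hS⟩ : {S : V → (V → Bool) → Option Bool // IsStrategy A S}))

open Classical in
/-- The words of length `n` whose last letter in `B` exists and lies in `A`. -/
noncomputable def lastMem {X : Type*} [Fintype X] (A B : Finset X) (n : ℕ) : Finset (Fin n → X) :=
  {f | ∃ i, f i ∈ A ∧ ∀ j, i < j → f j ∉ B}

theorem mem_lastMem {X : Type*} [Fintype X] {A B : Finset X} {n : ℕ} {f : Fin n → X} :
    f ∈ lastMem A B n ↔ ∃ i, f i ∈ A ∧ ∀ j, i < j → f j ∉ B := by
  simp [lastMem]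

open Classical in
/-- For `A ⊆ B`, the last letter of a word that is in `B` lies in `A` with chance `|A| / |B|`. -/
theorem card_lastMem_mul_card {X : Type*} [Fintype X] {A B : Finset X} (hAB : A ⊆ B) (n : ℕ) :
    (#(lastMem A B n) : ℚ) * #B =
      #A * ((Fintype.card X : ℚ) ^ n - ((Fintype.card X : ℚ) - #B) ^ n) := by
  induction n with
  | zero => simp [lastMem]
  | succ n ih =>
    have hfar : (#{g : Fin n → X | ∀ j, g j ∉ B} : ℚ) = ((Fintype.card X : ℚ) - #B) ^ n := by
      have h : ({g : Fin n → X | ∀ j, g j ∉ B} : Finset _) = Fintype.piFinset fun _ => Bᶜ := by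
        ext g; simp
      rw [h, Fintype.card_piFinset_const, card_compl, Nat.cast_pow, Nat.cast_sub (card_le_univ B)]
    have hrec : (#(lastMem A B (n + 1)) : ℚ) =
        Fintype.card X * #(lastMem A B n) +
          #A * #{g : Fin n → X | ∀ j, g j ∉ B} := by
      have hcard : #(lastMem A B (n + 1)) =
          #((univ : Finset X) ×ˢ lastMem A B n ∪
            A ×ˢ ({g : Fin n → X | ∀ j, g j ∉ B} : Finset _)) := by
        refine (card_equiv (Fin.consEquiv fun _ => X) ?_).symm
        rintro ⟨x, g⟩
        simp [mem_lastMem, Fin.consEquiv, Fin.exists_fin_succ, Fin.forall_fin_succ, or_comm]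
      rw [hcard, card_union_of_disjoint, card_product, card_product, card_univ]
      · push_cast; rfl
      · rw [disjoint_left]
        rintro ⟨x, g⟩ h₁ h₂
        simp only [mem_product, mem_lastMem, mem_filter, mem_univ, true_and] at h₁ h₂
        obtain ⟨i, hi, -⟩ := h₁
        exact h₂.2 i (hAB hi)
    rw [hrec, hfar]
    linear_combination (Fintype.card X : ℚ) * ih

/-- The colorings of `K_m` with exactly one red hat. -/
def oneRed (m : ℕ) : Finset (Fin m → Bool) :=
  univ.image fun a => Function.update (fun _ => false) a true

/-- The colorings of `K_m` with at most one red hat. -/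
def atMostOneRed (m : ℕ) : Finset (Fin m → Bool) := insert (fun _ => false) (oneRed m)

theorem oneRed_subset_atMostOneRed (m : ℕ) : oneRed m ⊆ atMostOneRed m :=
  subset_insert _ _

theorem card_oneRed (m : ℕ) : #(oneRed m) = m := by
  rw [oneRed, card_image_of_injective, card_univ, Fintype.card_fin]
  intro a b h
  by_contra hab
  simpa [hab] using congrFun h a

theorem card_atMostOneRed (m : ℕ) : #(atMostOneRed m) = m + 1 := by
  rw [atMostOneRed, card_insert_of_notMem, card_oneRed]
  simp only [oneRed, mem_image, mem_univ, true_and, not_exists]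
  intro a h
  simpa using congrFun h a

theorem mem_atMostOneRed {m : ℕ} {x : Fin m → Bool} {a : Fin m} (h : ∀ b, b ≠ a → x b = false) :
    x ∈ atMostOneRed m := by
  rw [atMostOneRed, mem_insert]
  cases hx : x a
  · left
    ext1 b
    by_cases hb : b = a
    · rw [hb, hx]
    · exact h b hb
  · right
    refine mem_image.2 ⟨a, mem_univ a, ?_⟩
    ext1 b
    by_cases hb : b = a
    · simp [hb, hx]
    · simp [hb, h b hb]

open Classical in
/-- A vertex guesses red when its copy is the last that may have at most one red hat and the other
hats of the copy are blue. -/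
noncomputable def lastCopyStrategy (m n : ℕ) (v : Fin n × Fin m) (c : Fin n × Fin m → Bool) :
    Option Bool :=
  if (∀ j, v.1 < j → (fun b => c (j, b)) ∉ atMostOneRed m) ∧ ∀ b, b ≠ v.2 → c (v.1, b) = false
  then some true else none

theorem isStrategy_lastCopyStrategy (m n : ℕ) :
    IsStrategy (KmPowN m n) (lastCopyStrategy m n) := by
  rintro ⟨i, a⟩ c c' h
  have h₁ : ∀ j, i < j → (fun b => c (j, b)) = fun b => c' (j, b) := fun j hj =>
    funext fun b => h (j, b) (Or.inl hj)
  have h₂ : ∀ b, b ≠ a → c (i, b) = c' (i, b) := fun b hb => h (i, b) (Or.inr ⟨rfl, hb.symm⟩)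
  unfold lastCopyStrategy
  congr 1
  refine propext (and_congr ?_ ?_)
  · exact forall₂_congr fun j hj => by rw [h₁ j hj]
  · exact forall₂_congr fun b hb => by rw [h₂ b hb]

theorem wins_lastCopyStrategy {m n : ℕ} {c : Fin n × Fin m → Bool} {i : Fin n}
    (hi : (fun b => c (i, b)) ∈ oneRed m)
    (hlast : ∀ j, i < j → (fun b => c (j, b)) ∉ atMostOneRed m) :
    Wins (lastCopyStrategy m n) c := by
  obtain ⟨a, -, ha⟩ := mem_image.1 hi
  have hia : c (i, a) = true := by simpa using (congrFun ha a).symm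
  have hib : ∀ b, b ≠ a → c (i, b) = false := fun b hb => by simpa [hb] using (congrFun ha b).symm
  refine ⟨⟨(i, a), ?_⟩, ?_⟩
  · rw [lastCopyStrategy, if_pos ⟨hlast, hib⟩, hia]
  · rintro ⟨j, b⟩ x hx
    unfold lastCopyStrategy at hx
    split_ifs at hx with h
    obtain rfl : true = x := Option.some.inj hx
    obtain ⟨hj, hb⟩ := h
    rcases lt_trichotomy j i with hji | rfl | hij
    · exact absurd (mem_insert_of_mem hi) (hj i hji)
    · by_cases hab : a = b
      · rw [← hab, hia]
      · rw [hb a hab] at hia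
        exact absurd hia Bool.false_ne_true
    · exact absurd (mem_atMostOneRed hb) (hlast j hij)

theorem card_lastMem_le_ncard_wins (m n : ℕ) :
    #(lastMem (oneRed m) (atMostOneRed m) n) ≤
      {c | Wins (lastCopyStrategy m n) c}.ncard := by
  rw [← Set.ncard_coe_finset]
  refine Set.ncard_le_ncard_of_injOn (fun f v => f v.1 v.2) ?_ ?_ (Set.toFinite _)
  · intro f hf
    obtain ⟨i, hi, hlast⟩ := mem_lastMem.1 (mem_coe.1 hf)
    exact wins_lastCopyStrategy hi hlast
  · intro f _ g _ h
    ext i a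
    exact congrFun h (i, a)

theorem count_bound_le_ncard_wins (m n : ℕ) :
    (m : ℚ) * ((2 ^ m) ^ n - (2 ^ m - ((m : ℚ) + 1)) ^ n) ≤
      ({c | Wins (lastCopyStrategy m n) c}.ncard : ℚ) * (m + 1) := by
  have hcount := card_lastMem_mul_card (oneRed_subset_atMostOneRed m) n
  have hle := (Nat.cast_le (α := ℚ)).2 (card_lastMem_le_ncard_wins m n)
  have hX : (Fintype.card (Fin m → Bool) : ℚ) = 2 ^ m := by simp
  rw [hX, card_oneRed, card_atMostOneRed, Nat.cast_succ] at hcount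
  rw [← hcount]
  exact mul_le_mul_of_nonneg_right hle (by positivity)

/-- For `m ≥ 1`, `n ≥ 0` and `c = (m+1)·2^{-m}` we have
`h(K_m^{→n}) ≥ (1 - (1-c)^n)·m/(m+1)`. -/
theorem hatNumber_KmPowN_ge (m n : ℕ) (hm : 1 ≤ m) :
    (1 - (1 - ((m : ℚ) + 1) / 2 ^ m) ^ n) * ((m : ℚ) / ((m : ℚ) + 1)) ≤
      hatNumber (KmPowN m n) := by
  refine le_trans ?_ (chance_le_hatNumber (isStrategy_lastCopyStrategy m n))
  have hpow : (1 - ((m : ℚ) + 1) / 2 ^ m) ^ n * (2 ^ m) ^ n = (2 ^ m - ((m : ℚ) + 1)) ^ n := by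
    rw [← mul_pow, sub_mul, one_mul, div_mul_cancel₀ _ (by positivity)]
  have hcard : (2 : ℚ) ^ Fintype.card (Fin n × Fin m) = (2 ^ m) ^ n := by
    rw [Fintype.card_prod, Fintype.card_fin, Fintype.card_fin, mul_comm, pow_mul]
  rw [chance, hcard, le_div_iff₀ (by positivity), mul_div_assoc', div_mul_eq_mul_div,
    div_le_iff₀ (by positivity)]
  refine le_of_eq_of_le ?_ (count_bound_le_ncard_wins m n)
  linear_combination (-(m : ℚ)) * hpow

end HatProblem
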